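/- Quantum conditional mutual information is monotone under local channels on one system: for any quantum channel N acting on system B, I(A:B|C)_ρ ≥ I(A:B'|C)_{N(ρ)}. -/

import Mathlib

open scoped BigOperators ComplexOrder Matrix

noncomputable section

namespace QI

/-- The von Neumann entropy of a matrix: `-∑ λᵢ log λᵢ` over its eigenvalues when the
matrix is Hermitian (and `0` otherwise). -/
def vnEntropy {n : Type*} [Fintype n] [DecidableEq n] (ρ : Matrix n n ℂ) : ℝ :=
  if h : ρ.IsHermitian then ∑ i, Real.negMulLog (h.eigenvalues i) else 0

/-- The density matrix `|ψ⟩⟨ψ|` of a pure state vector `ψ`. -/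
def pureDensity {n : Type*} (ψ : n → ℂ) : Matrix n n ℂ :=
  Matrix.vecMulVec ψ (star ψ)

variable {X Y Z : Type*} [Fintype X] [Fintype Y] [Fintype Z]

/-- Partial trace over the third factor of a tripartite system. -/
def ptr3 (ρ : Matrix (X × Y × Z) (X × Y × Z) ℂ) : Matrix (X × Y) (X × Y) ℂ :=
  Matrix.of fun p q => ∑ z, ρ (p.1, p.2, z) (q.1, q.2, z)

/-- Partial trace over the second factor of a tripartite system. -/
def ptr2 (ρ : Matrix (X × Y × Z) (X × Y × Z) ℂ) : Matrix (X × Z) (X × Z) ℂ :=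
  Matrix.of fun p q => ∑ y, ρ (p.1, y, p.2) (q.1, y, q.2)

/-- Partial trace over the first factor of a tripartite system. -/
def ptr1 (ρ : Matrix (X × Y × Z) (X × Y × Z) ℂ) : Matrix (Y × Z) (Y × Z) ℂ :=
  Matrix.of fun p q => ∑ x, ρ (x, p.1, p.2) (x, q.1, q.2)

/-- Reduced state on the first factor of a tripartite system. -/
def ptr23 (ρ : Matrix (X × Y × Z) (X × Y × Z) ℂ) : Matrix X X ℂ :=
  Matrix.of fun a b => ∑ y, ∑ z, ρ (a, y, z) (b, y, z)

/-- Reduced state on the second factor of a tripartite system. -/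
def ptr13 (ρ : Matrix (X × Y × Z) (X × Y × Z) ℂ) : Matrix Y Y ℂ :=
  Matrix.of fun a b => ∑ x, ∑ z, ρ (x, a, z) (x, b, z)

/-- Reduced state on the third factor of a tripartite system. -/
def ptr12 (ρ : Matrix (X × Y × Z) (X × Y × Z) ℂ) : Matrix Z Z ℂ :=
  Matrix.of fun a b => ∑ x, ∑ y, ρ (x, y, a) (x, y, b)

/-- Conditional mutual information `I(X:Y|Z) = S(XZ) + S(YZ) - S(Z) - S(XYZ)`
for a state on `X × Y × Z`. -/
def cmi (ρ : Matrix (X × Y × Z) (X × Y × Z) ℂ) [DecidableEq X] [DecidableEq Y]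
    [DecidableEq Z] : ℝ :=
  vnEntropy (ptr2 ρ) + vnEntropy (ptr1 ρ) - vnEntropy (ptr12 ρ) - vnEntropy ρ

/-- The action of a quantum channel, given by Kraus operators `K`, on the middle
system `B` of a tripartite state on `A × B × C`, producing a state on `A × B' × C`. -/
def applyKrausMiddle {A B C B' ι : Type*} [Fintype B] [Fintype ι]
    (K : ι → Matrix B' B ℂ) (ρ : Matrix (A × B × C) (A × B × C) ℂ) :
    Matrix (A × B' × C) (A × B' × C) ℂ :=
  Matrix.of fun p q =>
    ∑ i, ∑ b, ∑ b', K i p.2.1 b * ρ (p.1, b, p.2.2) (q.1, b', q.2.2) * star (K i q.2.1 b')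

section Helpers

open Matrix Kronecker

section
variable {m n κ : Type*} [Fintype m] [Fintype n] [Fintype κ]

/-- The Schwarz inequality for the adjoint of a channel, paired with a positive matrix. -/
theorem re_trace_schwarz [DecidableEq n] (L : κ → Matrix m n ℂ) (hL : ∑ k, (L k)ᴴ * L k = 1)
    {σ : Matrix n n ℂ} (hσ : σ.PosSemidef) (X : Matrix m m ℂ) :
    (σ * ((∑ k, (L k)ᴴ * X * L k) * (∑ k, (L k)ᴴ * X * L k)ᴴ)).trace.re ≤
      ((∑ k, L k * σ * (L k)ᴴ) * (X * Xᴴ)).trace.re := by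
  set W := ∑ k, (L k)ᴴ * X * L k with hW
  have hWs : ∑ k, (L k)ᴴ * Xᴴ * L k = Wᴴ := by
    simp [hW, conjTranspose_sum, Matrix.mul_assoc]
  have key : ∑ k, (Xᴴ * L k - L k * Wᴴ)ᴴ * (Xᴴ * L k - L k * Wᴴ) =
      ∑ k, (L k)ᴴ * (X * Xᴴ) * L k - W * Wᴴ := by
    have h1 : ∀ k, (Xᴴ * L k - L k * Wᴴ)ᴴ * (Xᴴ * L k - L k * Wᴴ) =
        (L k)ᴴ * (X * Xᴴ) * L k - (L k)ᴴ * X * L k * Wᴴ - W * ((L k)ᴴ * Xᴴ * L k)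
          + W * ((L k)ᴴ * L k) * Wᴴ := by
      intro k
      simp only [conjTranspose_sub, conjTranspose_mul, conjTranspose_conjTranspose]
      simp only [Matrix.sub_mul, Matrix.mul_sub, Matrix.mul_assoc]
      abel
    simp_rw [h1, Finset.sum_add_distrib, Finset.sum_sub_distrib, ← Finset.sum_mul,
      ← Finset.mul_sum, hL, hWs, ← hW]
    simp
  have hpos : 0 ≤ (σ * ∑ k, (Xᴴ * L k - L k * Wᴴ)ᴴ * (Xᴴ * L k - L k * Wᴴ)).trace := by
    rw [Finset.mul_sum, trace_sum]
    refine Finset.sum_nonneg fun k _ => ?_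
    rw [← Matrix.mul_assoc, trace_mul_comm, ← Matrix.mul_assoc]
    exact (hσ.mul_mul_conjTranspose_same _).trace_nonneg
  have htr : (σ * ∑ k, (L k)ᴴ * (X * Xᴴ) * L k).trace =
      ((∑ k, L k * σ * (L k)ᴴ) * (X * Xᴴ)).trace := by
    rw [Finset.mul_sum, trace_sum, Finset.sum_mul, trace_sum]
    refine Finset.sum_congr rfl fun k _ => ?_
    rw [← Matrix.mul_assoc, trace_mul_comm]
    simp only [Matrix.mul_assoc]
  rw [key, Matrix.mul_sub, trace_sub, htr] at hpos
  have := (Complex.le_def.1 hpos).1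
  simp at this
  simpa using this

/-- The concave quadratic functional whose maximum over `X` is
`⟪ρ, (σ · + t · ρ)⁻¹ ρ⟫` in the Hilbert–Schmidt inner product. -/
def quadFunctional (ρ σ : Matrix n n ℂ) (t : ℝ) (X : Matrix n n ℂ) : ℝ :=
  2 * (Xᴴ * ρ).trace.re - (σ * (X * Xᴴ)).trace.re - t * (ρ * (Xᴴ * X)).trace.re

theorem quadFunctional_channel_le [DecidableEq n] (L : κ → Matrix m n ℂ)
    (hL : ∑ k, (L k)ᴴ * L k = 1) {ρ σ : Matrix n n ℂ} (hρ : ρ.PosSemidef) (hσ : σ.PosSemidef)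
    {t : ℝ} (ht : 0 ≤ t) (X : Matrix m m ℂ) :
    quadFunctional (∑ k, L k * ρ * (L k)ᴴ) (∑ k, L k * σ * (L k)ᴴ) t X ≤
      quadFunctional ρ σ t (∑ k, (L k)ᴴ * X * L k) := by
  have h1 := re_trace_schwarz L hL hσ X
  have h2 := re_trace_schwarz L hL hρ Xᴴ
  have hWs : ∑ k, (L k)ᴴ * Xᴴ * L k = (∑ k, (L k)ᴴ * X * L k)ᴴ := by
    simp [conjTranspose_sum, Matrix.mul_assoc]
  have h3 : ((∑ k, (L k)ᴴ * X * L k)ᴴ * ρ).trace = (Xᴴ * ∑ k, L k * ρ * (L k)ᴴ).trace := by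
    rw [← hWs, Finset.sum_mul, Finset.mul_sum, trace_sum, trace_sum]
    refine Finset.sum_congr rfl fun k _ => ?_
    rw [Matrix.mul_assoc, Matrix.mul_assoc, trace_mul_comm, Matrix.mul_assoc]
  rw [hWs, conjTranspose_conjTranspose, conjTranspose_conjTranspose] at h2
  unfold quadFunctional
  rw [h3]
  nlinarith [mul_le_mul_of_nonneg_left h2 ht]

theorem quadFunctional_diagonal [DecidableEq n] {U V : Matrix n n ℂ} (hU : Uᴴ * U = 1)
    (hV : Vᴴ * V = 1) (p q : n → ℝ) (t : ℝ) (Y : Matrix n n ℂ) :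
    quadFunctional (U * diagonal (fun i => (p i : ℂ)) * Uᴴ)
      (V * diagonal (fun i => (q i : ℂ)) * Vᴴ) t (V * Y * Uᴴ) =
      ∑ i, ∑ j, (2 * p i * (star (Y j i) * (Vᴴ * U) j i).re -
        (q j + t * p i) * Complex.normSq (Y j i)) := by
  have h1 : ((V * Y * Uᴴ)ᴴ * (U * diagonal (fun i => (p i : ℂ)) * Uᴴ)).trace =
      (Yᴴ * (Vᴴ * U) * diagonal (fun i => (p i : ℂ))).trace := by
    simp only [conjTranspose_mul, conjTranspose_conjTranspose]
    rw [← Matrix.mul_assoc, trace_mul_comm]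
    simp only [← Matrix.mul_assoc, hU, Matrix.one_mul]
  have h2 : ((V * diagonal (fun i => (q i : ℂ)) * Vᴴ) *
      ((V * Y * Uᴴ) * (V * Y * Uᴴ)ᴴ)).trace =
      (Yᴴ * (diagonal (fun i => (q i : ℂ)) * Y)).trace := by
    have : (V * diagonal (fun i => (q i : ℂ)) * Vᴴ) *
      ((V * Y * Uᴴ) * (V * Y * Uᴴ)ᴴ) =
      V * (diagonal (fun i => (q i : ℂ)) * (Vᴴ * V) * Y * (Uᴴ * U) * Yᴴ * Vᴴ) := by
      simp only [conjTranspose_mul, conjTranspose_conjTranspose, Matrix.mul_assoc]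
    rw [this, hU, hV, trace_mul_comm, Matrix.mul_assoc _ Vᴴ, hV, Matrix.mul_one, Matrix.mul_one,
      Matrix.mul_one, trace_mul_comm]
  have h3 : ((U * diagonal (fun i => (p i : ℂ)) * Uᴴ) *
      ((V * Y * Uᴴ)ᴴ * (V * Y * Uᴴ))).trace =
      (Yᴴ * Y * diagonal (fun i => (p i : ℂ))).trace := by
    have : (U * diagonal (fun i => (p i : ℂ)) * Uᴴ) *
      ((V * Y * Uᴴ)ᴴ * (V * Y * Uᴴ)) =
      U * (diagonal (fun i => (p i : ℂ)) * (Uᴴ * U) * Yᴴ * (Vᴴ * V) * Y * Uᴴ) := by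
      simp only [conjTranspose_mul, conjTranspose_conjTranspose, Matrix.mul_assoc]
    rw [this, hU, hV, trace_mul_comm, Matrix.mul_assoc _ Uᴴ, hU, Matrix.mul_one, Matrix.mul_one,
      Matrix.mul_one, Matrix.mul_assoc, trace_mul_comm]
  unfold quadFunctional
  rw [h1, h2, h3]
  generalize Vᴴ * U = w
  simp only [trace, diag_apply, mul_diagonal, diagonal_mul, Matrix.mul_apply (M := Yᴴ),
    conjTranspose_apply, Complex.re_sum, Finset.mul_sum, Finset.sum_mul,
    ← Finset.sum_sub_distrib]
  refine Finset.sum_congr rfl fun i _ => Finset.sum_congr rfl fun j _ => ?_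
  simp [Complex.normSq_apply]
  ring

/-- The value of `⟪ρ, (σ · + t · ρ)⁻¹ ρ⟫` for `ρ`, `σ` with eigenvalues `p`, `q` and overlap
matrix `w` of the eigenbases. -/
def resolventForm (w : Matrix n n ℂ) (p q : n → ℝ) (t : ℝ) : ℝ :=
  ∑ i, ∑ j, Complex.normSq (w j i) * p i * (p i / (q j + t * p i))

theorem quadFunctional_le_resolventForm [DecidableEq n] {U V : Matrix n n ℂ} (hU : Uᴴ * U = 1)
    (hV : Vᴴ * V = 1) {p q : n → ℝ} (hp : 0 ≤ p) (hq : 0 ≤ q) {t : ℝ} (ht : 0 < t)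
    (X : Matrix n n ℂ) :
    quadFunctional (U * diagonal (fun i => (p i : ℂ)) * Uᴴ)
      (V * diagonal (fun i => (q i : ℂ)) * Vᴴ) t X ≤ resolventForm (Vᴴ * U) p q t := by
  have hX : X = V * (Vᴴ * X * U) * Uᴴ := by
    have hU' := mul_eq_one_comm.1 hU
    have hV' := mul_eq_one_comm.1 hV
    have : V * (Vᴴ * X * U) * Uᴴ = (V * Vᴴ) * X * (U * Uᴴ) := by
      simp only [Matrix.mul_assoc]
    rw [this, hU', hV', Matrix.one_mul, Matrix.mul_one]
  rw [hX, quadFunctional_diagonal hU hV]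
  refine Finset.sum_le_sum fun i _ => Finset.sum_le_sum fun j _ => ?_
  generalize (Vᴴ * X * U) j i = y
  generalize (Vᴴ * U) j i = w
  rcases (hp i).eq_or_lt with h | h
  · simp only [Pi.zero_apply] at h
    simp only [← h]
    simpa using mul_nonneg (hq j) (Complex.normSq_nonneg y)
  · have hd : 0 < q j + t * p i := add_pos_of_nonneg_of_pos (hq j) (mul_pos ht h)
    generalize q j + t * p i = d at hd
    rw [mul_div_assoc', le_div_iff₀ hd]
    simp [Complex.normSq_apply]
    nlinarith [sq_nonneg (d * y.re - p i * w.re), sq_nonneg (d * y.im - p i * w.im)]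

theorem exists_quadFunctional_eq_resolventForm [DecidableEq n] {U V : Matrix n n ℂ}
    (hU : Uᴴ * U = 1) (hV : Vᴴ * V = 1) {p q : n → ℝ} (hp : 0 ≤ p) (hq : 0 ≤ q) {t : ℝ}
    (ht : 0 < t) :
    ∃ X, quadFunctional (U * diagonal (fun i => (p i : ℂ)) * Uᴴ)
      (V * diagonal (fun i => (q i : ℂ)) * Vᴴ) t X = resolventForm (Vᴴ * U) p q t := by
  refine ⟨V * (of fun j i => ((p i / (q j + t * p i) : ℝ) : ℂ) * (Vᴴ * U) j i) * Uᴴ, ?_⟩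
  rw [quadFunctional_diagonal hU hV]
  refine Finset.sum_congr rfl fun i _ => Finset.sum_congr rfl fun j _ => ?_
  simp only [of_apply]
  generalize (Vᴴ * U) j i = w
  rcases (hp i).eq_or_lt with h | h
  · simp only [Pi.zero_apply] at h
    simp [← h]
  · have hd : 0 < q j + t * p i := add_pos_of_nonneg_of_pos (hq j) (mul_pos ht h)
    generalize q j + t * p i = d at hd
    rw [Complex.normSq_mul, Complex.normSq_ofReal]
    simp only [star_mul', RCLike.star_def, Complex.conj_ofReal, mul_assoc, Complex.re_ofReal_mul,
      ← Complex.normSq_eq_conj_mul_self, Complex.ofReal_re]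
    field_simp
    ring

/-- An antiderivative in `t` of `resolventForm w p q t`. -/
def logPotential (w : Matrix n n ℂ) (p q : n → ℝ) (t : ℝ) : ℝ :=
  ∑ i, ∑ j, Complex.normSq (w j i) * p i * Real.log (q j + t * p i)

theorem hasDerivAt_logPotential (w : Matrix n n ℂ) {p q : n → ℝ} (hp : 0 ≤ p) (hq : 0 ≤ q)
    {t : ℝ} (ht : 0 < t) :
    HasDerivAt (logPotential w p q) (resolventForm w p q t) t := by
  unfold logPotential resolventForm
  refine HasDerivAt.fun_sum fun i _ => HasDerivAt.fun_sum fun j _ => ?_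
  rcases (hp i).eq_or_lt with h | h
  · simp only [Pi.zero_apply] at h
    simpa [← h] using hasDerivAt_const t (0 : ℝ)
  · have hd : 0 < q j + t * p i := add_pos_of_nonneg_of_pos (hq j) (mul_pos ht h)
    have h1 : HasDerivAt (fun t => q j + t * p i) (p i) t := by
      simpa using ((hasDerivAt_id t).mul_const (p i)).const_add (q j)
    exact (h1.log hd.ne').const_mul _

theorem continuousOn_logPotential (w : Matrix n n ℂ) {p q : n → ℝ} (hp : 0 ≤ p) (hq : 0 ≤ q)
    (hsupp : ∀ i j, q j = 0 → Complex.normSq (w j i) * p i = 0) :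
    ContinuousOn (logPotential w p q) (Set.Ici 0) := by
  unfold logPotential
  refine continuousOn_finsetSum _ fun i _ => continuousOn_finsetSum _ fun j _ => ?_
  by_cases h : q j = 0
  · simpa [hsupp i j h] using continuousOn_const
  · have hd : ∀ t ∈ Set.Ici (0 : ℝ), q j + t * p i ≠ 0 := fun t ht =>
      (add_pos_of_pos_of_nonneg ((hq j).lt_of_ne' h) (mul_nonneg ht (hp i))).ne'
    exact continuousOn_const.mul (ContinuousOn.log (by fun_prop) hd)

open Filter Topology in
theorem tendsto_logPotential {w : Matrix n n ℂ} (hw : ∀ i, ∑ j, Complex.normSq (w j i) = 1)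
    {p q : n → ℝ} (hp : 0 ≤ p) (hq : 0 ≤ q) :
    Tendsto (fun t => logPotential w p q t - (∑ i, p i) * Real.log t) atTop
      (𝓝 (∑ i, p i * Real.log (p i))) := by
  have h0 : ∀ i j, Tendsto (fun t => Complex.normSq (w j i) * p i * Real.log (q j + t * p i) -
      Complex.normSq (w j i) * p i * Real.log t) atTop
      (𝓝 (Complex.normSq (w j i) * p i * Real.log (p i))) := by
    intro i j
    rcases (hp i).eq_or_lt with h | h
    · simp only [Pi.zero_apply] at h
      simp [← h]
    · have h1 : Tendsto (fun t : ℝ => q j * t⁻¹ + p i) atTop (𝓝 (p i)) := by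
        simpa using (tendsto_inv_atTop_zero.const_mul (q j)).add_const (p i)
      refine ((h1.log h.ne').const_mul (Complex.normSq (w j i) * p i)).congr' ?_
      filter_upwards [eventually_gt_atTop 0] with t ht
      have hd : 0 < q j + t * p i := add_pos_of_nonneg_of_pos (hq j) (mul_pos ht h)
      rw [← mul_sub, ← Real.log_div hd.ne' ht.ne']
      congr 2
      field_simp
  have h1 := tendsto_finsetSum Finset.univ fun i _ =>
    tendsto_finsetSum Finset.univ fun j _ => h0 i j
  convert h1 using 2 with t
  · simp_rw [Finset.sum_sub_distrib, mul_assoc, ← Finset.sum_mul, hw, one_mul, Finset.sum_mul]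
    simp [logPotential, mul_assoc]
  · simp_rw [mul_assoc, ← Finset.sum_mul, hw, one_mul]

theorem sum_normSq_overlap [DecidableEq n] {U V : Matrix n n ℂ} (hU : Uᴴ * U = 1)
    (hV : Vᴴ * V = 1) (i : n) : ∑ j, Complex.normSq ((Vᴴ * U) j i) = 1 := by
  have h : (Vᴴ * U)ᴴ * (Vᴴ * U) = 1 := by
    rw [conjTranspose_mul, conjTranspose_conjTranspose, Matrix.mul_assoc, ← Matrix.mul_assoc V,
      mul_eq_one_comm.1 hV, Matrix.one_mul, hU]
  have h1 := congrFun (congrFun h i) i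
  rw [Matrix.mul_apply, one_apply_eq] at h1
  simp only [conjTranspose_apply, RCLike.star_def, ← Complex.normSq_eq_conj_mul_self] at h1
  exact_mod_cast h1

/-- Monotonicity of the relative entropy `Tr ρ log ρ - Tr ρ log σ` under a channel, in terms of
eigenvalues and overlaps of eigenbases. -/
theorem relEntropy_channel_le [DecidableEq m] [DecidableEq n] (L : κ → Matrix m n ℂ)
    (hL : ∑ k, (L k)ᴴ * L k = 1)
    {U V : Matrix n n ℂ} (hU : Uᴴ * U = 1) (hV : Vᴴ * V = 1)
    {p q : n → ℝ} (hp : 0 ≤ p) (hq : 0 ≤ q)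
    (hsupp : ∀ i j, q j = 0 → Complex.normSq ((Vᴴ * U) j i) * p i = 0)
    {U' V' : Matrix m m ℂ} (hU' : U'ᴴ * U' = 1) (hV' : V'ᴴ * V' = 1)
    {p' q' : m → ℝ} (hp' : 0 ≤ p') (hq' : 0 ≤ q')
    (hsupp' : ∀ i j, q' j = 0 → Complex.normSq ((V'ᴴ * U') j i) * p' i = 0)
    (hρ : ∑ k, L k * (U * diagonal (fun i => (p i : ℂ)) * Uᴴ) * (L k)ᴴ =
      U' * diagonal (fun i => (p' i : ℂ)) * U'ᴴ)
    (hσ : ∑ k, L k * (V * diagonal (fun i => (q i : ℂ)) * Vᴴ) * (L k)ᴴ =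
      V' * diagonal (fun i => (q' i : ℂ)) * V'ᴴ)
    (hsum : ∑ i, p i = ∑ i, p' i) :
    ∑ i, p' i * Real.log (p' i) - logPotential (V'ᴴ * U') p' q' 0 ≤
      ∑ i, p i * Real.log (p i) - logPotential (Vᴴ * U) p q 0 := by
  have hpsd : ∀ {W : Matrix n n ℂ} {r : n → ℝ}, 0 ≤ r →
      (W * diagonal (fun i => (r i : ℂ)) * Wᴴ).PosSemidef := fun hr =>
    (PosSemidef.diagonal fun i => by simpa using hr i).mul_mul_conjTranspose_same _
  have hG : ∀ t, 0 < t → resolventForm (V'ᴴ * U') p' q' t ≤ resolventForm (Vᴴ * U) p q t := by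
    intro t ht
    obtain ⟨X, hX⟩ := exists_quadFunctional_eq_resolventForm hU' hV' hp' hq' ht
    rw [← hX, ← hρ, ← hσ]
    exact (quadFunctional_channel_le L hL (hpsd hp) (hpsd hq) ht.le X).trans
      (quadFunctional_le_resolventForm hU hV hp hq ht _)
  have hderiv : ∀ t, 0 < t → HasDerivAt
      (fun t => logPotential (Vᴴ * U) p q t - logPotential (V'ᴴ * U') p' q' t)
      (resolventForm (Vᴴ * U) p q t - resolventForm (V'ᴴ * U') p' q' t) t := fun t ht =>
    (hasDerivAt_logPotential _ hp hq ht).sub (hasDerivAt_logPotential _ hp' hq' ht)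
  have hmono : MonotoneOn
      (fun t => logPotential (Vᴴ * U) p q t - logPotential (V'ᴴ * U') p' q' t) (Set.Ici 0) := by
    refine monotoneOn_of_deriv_nonneg (convex_Ici 0)
      ((continuousOn_logPotential _ hp hq hsupp).sub
        (continuousOn_logPotential _ hp' hq' hsupp')) ?_ ?_
    · intro t ht
      rw [interior_Ici] at ht
      exact (hderiv t ht).differentiableAt.differentiableWithinAt
    · intro t ht
      rw [interior_Ici] at ht
      rw [(hderiv t ht).deriv]
      exact sub_nonneg.2 (hG t ht)
  have hlim := (tendsto_logPotential (sum_normSq_overlap hU hV) hp hq).sub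
    (tendsto_logPotential (sum_normSq_overlap hU' hV') hp' hq')
  have hle := ge_of_tendsto hlim (b := logPotential (Vᴴ * U) p q 0 -
    logPotential (V'ᴴ * U') p' q' 0) (by
      filter_upwards [Filter.eventually_ge_atTop 0] with t ht
      have := hmono Set.self_mem_Ici ht ht
      simp only at this
      rw [hsum]
      linarith)
  linarith

end

section
variable {α M M' κ : Type*} [Fintype α]

/-- Partial trace over the left factor of a bipartite system. -/
def traceLeft (ρ : Matrix (α × M) (α × M) ℂ) : Matrix M M ℂ :=
  of fun p q => ∑ a, ρ (a, p) (a, q)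

theorem posSemidef_traceLeft {ρ : Matrix (α × M) (α × M) ℂ} (hρ : ρ.PosSemidef) :
    (traceLeft ρ).PosSemidef := by
  have : traceLeft ρ = ∑ a, ρ.submatrix (fun x => (a, x)) (fun x => (a, x)) := by
    ext p q
    simp [traceLeft, Matrix.sum_apply]
  rw [this]
  exact posSemidef_sum _ fun a _ => hρ.submatrix _

theorem traceLeft_one_kronecker_mul_mul [Fintype M] [DecidableEq α] (L : Matrix M' M ℂ)
    (ρ : Matrix (α × M) (α × M) ℂ) :
    traceLeft (((1 : Matrix α α ℂ) ⊗ₖ L) * ρ * ((1 : Matrix α α ℂ) ⊗ₖ L)ᴴ) =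
      L * traceLeft ρ * Lᴴ := by
  ext x y
  simp only [traceLeft, of_apply, Matrix.mul_apply, Fintype.sum_prod_type, kroneckerMap_apply,
    conjTranspose_apply, one_apply, ite_mul, one_mul, zero_mul, Finset.sum_ite_irrel,
    Finset.sum_const_zero, Finset.sum_ite_eq, Finset.mem_univ, if_true, apply_ite star, star_zero,
    mul_ite, mul_zero, Finset.mul_sum, Finset.sum_mul]
  rw [Finset.sum_comm]
  refine Finset.sum_congr rfl fun _ _ => Finset.sum_comm

theorem exists_diagonalization {n : Type*} [Fintype n] [DecidableEq n] {ρ : Matrix n n ℂ}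
    (hρ : ρ.PosSemidef) :
    ∃ (U : Matrix n n ℂ) (p : n → ℝ), Uᴴ * U = 1 ∧ 0 ≤ p ∧
      ρ = U * diagonal (fun i => (p i : ℂ)) * Uᴴ ∧
      ∑ i, p i * Real.log (p i) = -vnEntropy ρ := by
  refine ⟨hρ.isHermitian.eigenvectorUnitary, hρ.isHermitian.eigenvalues, ?_,
    fun i => hρ.eigenvalues_nonneg i, ?_, ?_⟩
  · exact Unitary.coe_star_mul_self hρ.isHermitian.eigenvectorUnitary
  · exact hρ.isHermitian.spectral_theorem
  · simp [vnEntropy, hρ.isHermitian, Real.negMulLog]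

theorem sum_eq_trace_re {n : Type*} [Fintype n] [DecidableEq n] {U : Matrix n n ℂ}
    (hU : Uᴴ * U = 1) (p : n → ℝ) :
    ∑ i, p i = (U * diagonal (fun i => (p i : ℂ)) * Uᴴ).trace.re := by
  rw [trace_mul_comm, ← Matrix.mul_assoc, hU, Matrix.one_mul, trace_diagonal]
  simp

/-- The relative entropy of `ρ` and `1 ⊗ Tr₁ ρ` in terms of eigenvalues and eigenbases. -/
theorem exists_diagonalization_one_kronecker_traceLeft [Fintype M] [DecidableEq α] [DecidableEq M]
    {ρ : Matrix (α × M) (α × M) ℂ} (hρ : ρ.PosSemidef) :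
    ∃ (U V : Matrix (α × M) (α × M) ℂ) (p q : α × M → ℝ), Uᴴ * U = 1 ∧ Vᴴ * V = 1 ∧
      0 ≤ p ∧ 0 ≤ q ∧ ρ = U * diagonal (fun i => (p i : ℂ)) * Uᴴ ∧
      (1 : Matrix α α ℂ) ⊗ₖ traceLeft ρ = V * diagonal (fun i => (q i : ℂ)) * Vᴴ ∧
      (∀ i j, q j = 0 → Complex.normSq ((Vᴴ * U) j i) * p i = 0) ∧
      ∑ i, p i * Real.log (p i) = -vnEntropy ρ ∧
      logPotential (Vᴴ * U) p q 0 = -vnEntropy (traceLeft ρ) := by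
  obtain ⟨U, p, hU, hp, hρU, hSp⟩ := exists_diagonalization hρ
  obtain ⟨V, q, hV, hq, hσV, hSq⟩ := exists_diagonalization (posSemidef_traceLeft hρ)
  have hmarg : ∀ m, ∑ a, ∑ i, Complex.normSq ((((1 : Matrix α α ℂ) ⊗ₖ V)ᴴ * U) (a, m) i) * p i =
      q m := by
    intro m
    have h1 : ∀ a, ((∑ i, Complex.normSq ((((1 : Matrix α α ℂ) ⊗ₖ V)ᴴ * U) (a, m) i) * p i : ℝ)
        : ℂ) = (((1 : Matrix α α ℂ) ⊗ₖ V)ᴴ * ρ * ((1 : Matrix α α ℂ) ⊗ₖ V)) (a, m) (a, m) := by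
      intro a
      have h2 : ((1 : Matrix α α ℂ) ⊗ₖ V)ᴴ * ρ * ((1 : Matrix α α ℂ) ⊗ₖ V) =
          (((1 : Matrix α α ℂ) ⊗ₖ V)ᴴ * U) * diagonal (fun i => (p i : ℂ)) *
            (((1 : Matrix α α ℂ) ⊗ₖ V)ᴴ * U)ᴴ := by
        conv_lhs => rw [hρU]
        simp only [conjTranspose_mul, conjTranspose_conjTranspose, Matrix.mul_assoc]
      rw [h2, Matrix.mul_apply]
      generalize ((1 : Matrix α α ℂ) ⊗ₖ V)ᴴ * U = w
      push_cast
      refine Finset.sum_congr rfl fun i _ => ?_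
      rw [mul_diagonal, conjTranspose_apply, Complex.normSq_eq_conj_mul_self, RCLike.star_def]
      ring
    have h3 : traceLeft (((1 : Matrix α α ℂ) ⊗ₖ V)ᴴ * ρ * ((1 : Matrix α α ℂ) ⊗ₖ V)) =
        Vᴴ * traceLeft ρ * V := by
      simpa [conjTranspose_kronecker] using
        traceLeft_one_kronecker_mul_mul Vᴴ ρ
    have h4 : Vᴴ * traceLeft ρ * V = diagonal (fun i => (q i : ℂ)) := by
      rw [hσV, Matrix.mul_assoc, Matrix.mul_assoc, Matrix.mul_assoc, hV, Matrix.mul_one,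
        ← Matrix.mul_assoc, hV, Matrix.one_mul]
    have h5 := congrFun (congrFun (h3.trans h4) m) m
    rw [diagonal_apply_eq] at h5
    simp only [traceLeft, of_apply, ← h1] at h5
    exact_mod_cast h5
  refine ⟨U, (1 : Matrix α α ℂ) ⊗ₖ V, p, fun x => q x.2, hU, ?_, hp, fun x => hq x.2, hρU, ?_, ?_,
    hSp, ?_⟩
  · rw [conjTranspose_kronecker, ← mul_kronecker_mul, hV]
    simp
  · have : diagonal (fun i : α × M => (q i.2 : ℂ)) =
        (1 : Matrix α α ℂ) ⊗ₖ diagonal (fun i => (q i : ℂ)) := by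
      rw [← diagonal_one, diagonal_kronecker_diagonal]
      simp
    rw [this, conjTranspose_kronecker, ← mul_kronecker_mul, ← mul_kronecker_mul, ← hσV]
    simp
  · rintro i ⟨a, m⟩ h
    have h0 := hmarg m
    rw [show q m = 0 from h] at h0
    have hnn : ∀ a i, 0 ≤ Complex.normSq ((((1 : Matrix α α ℂ) ⊗ₖ V)ᴴ * U) (a, m) i) * p i :=
      fun a i => mul_nonneg (Complex.normSq_nonneg _) (hp i)
    have h1 := (Finset.sum_eq_zero_iff_of_nonneg
      fun a _ => Finset.sum_nonneg fun i _ => hnn a i).1 h0 a (Finset.mem_univ _)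
    exact (Finset.sum_eq_zero_iff_of_nonneg fun i _ => hnn a i).1 h1 i (Finset.mem_univ _)
  · rw [← hSq, logPotential, Finset.sum_comm, Fintype.sum_prod_type_right]
    refine Finset.sum_congr rfl fun m _ => ?_
    simp only [zero_mul, add_zero, ← Finset.sum_mul, hmarg]

/-- A channel on the right factor does not increase `S(Tr₁ ρ) - S(ρ)`. -/
theorem vnEntropy_traceLeft_sub_channel_le [Fintype M] [Fintype M'] [Fintype κ]
    [DecidableEq α] [DecidableEq M] [DecidableEq M']
    (L : κ → Matrix M' M ℂ) (hL : ∑ k, (L k)ᴴ * L k = 1)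
    {ρ : Matrix (α × M) (α × M) ℂ} (hρ : ρ.PosSemidef) {ρ' : Matrix (α × M') (α × M') ℂ}
    (hρ' : ρ' = ∑ k, ((1 : Matrix α α ℂ) ⊗ₖ L k) * ρ * ((1 : Matrix α α ℂ) ⊗ₖ L k)ᴴ) :
    vnEntropy (traceLeft ρ') - vnEntropy ρ' ≤ vnEntropy (traceLeft ρ) - vnEntropy ρ := by
  have hpsd : ρ'.PosSemidef := by
    rw [hρ']
    exact posSemidef_sum _ fun k _ => hρ.mul_mul_conjTranspose_same _
  have hN : ∑ k, ((1 : Matrix α α ℂ) ⊗ₖ L k)ᴴ * ((1 : Matrix α α ℂ) ⊗ₖ L k) = 1 := by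
    simp_rw [conjTranspose_kronecker, ← mul_kronecker_mul, conjTranspose_one, Matrix.one_mul]
    rw [← one_kronecker_one, ← hL]
    ext x y
    simp [Matrix.sum_apply, Finset.mul_sum]
  have hσ' : (1 : Matrix α α ℂ) ⊗ₖ traceLeft ρ' = ∑ k, ((1 : Matrix α α ℂ) ⊗ₖ L k) *
      ((1 : Matrix α α ℂ) ⊗ₖ traceLeft ρ) * ((1 : Matrix α α ℂ) ⊗ₖ L k)ᴴ := by
    have h1 : traceLeft ρ' = ∑ k, L k * traceLeft ρ * (L k)ᴴ := by
      simp_rw [← traceLeft_one_kronecker_mul_mul]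
      rw [hρ']
      ext x y
      simp only [traceLeft, of_apply, Matrix.sum_apply]
      exact Finset.sum_comm
    simp_rw [conjTranspose_kronecker, ← mul_kronecker_mul, conjTranspose_one, Matrix.one_mul]
    rw [h1]
    ext x y
    simp [Matrix.sum_apply, Finset.mul_sum]
  have htr : ρ'.trace = ρ.trace := by
    rw [hρ', trace_sum]
    simp_rw [trace_mul_comm _ (((1 : Matrix α α ℂ) ⊗ₖ L _)ᴴ), ← Matrix.mul_assoc]
    rw [← trace_sum, ← Finset.sum_mul, hN, Matrix.one_mul]
  obtain ⟨U, V, p, q, hU, hV, hp, hq, hρU, hσV, hsupp, hS, hT⟩ :=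
    exists_diagonalization_one_kronecker_traceLeft hρ
  obtain ⟨U', V', p', q', hU', hV', hp', hq', hρU', hσV', hsupp', hS', hT'⟩ :=
    exists_diagonalization_one_kronecker_traceLeft hpsd
  have := relEntropy_channel_le _ hN hU hV hp hq hsupp hU' hV' hp' hq' hsupp'
    (by rw [← hρU, ← hρU', hρ']) (by rw [← hσV, ← hσV', hσ'])
    (by rw [sum_eq_trace_re hU, sum_eq_trace_re hU', ← hρU, ← hρU', htr])
  rw [hS, hT, hS', hT'] at this
  linarith

end

theorem sum_conjTranspose_kronecker_one {B C B' ι : Type*}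
    [Fintype C] [Fintype B'] [Fintype ι] [DecidableEq B] [DecidableEq C]
    {K : ι → Matrix B' B ℂ} (hK : ∑ i, (K i)ᴴ * K i = 1) :
    ∑ i, (K i ⊗ₖ (1 : Matrix C C ℂ))ᴴ * (K i ⊗ₖ (1 : Matrix C C ℂ)) = 1 := by
  simp_rw [conjTranspose_kronecker, ← mul_kronecker_mul, conjTranspose_one, Matrix.one_mul]
  rw [← one_kronecker_one, ← hK]
  ext x y
  simp [Matrix.sum_apply, Finset.sum_mul]

section
variable {A B C B' ι : Type*} [Fintype B] [Fintype ι]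

theorem applyKrausMiddle_eq_sum [Fintype A] [Fintype C] [DecidableEq A] [DecidableEq C]
    (K : ι → Matrix B' B ℂ)
    (ρ : Matrix (A × B × C) (A × B × C) ℂ) :
    applyKrausMiddle K ρ = ∑ i, ((1 : Matrix A A ℂ) ⊗ₖ (K i ⊗ₖ (1 : Matrix C C ℂ))) * ρ *
      ((1 : Matrix A A ℂ) ⊗ₖ (K i ⊗ₖ (1 : Matrix C C ℂ)))ᴴ := by
  ext ⟨a, b, c⟩ ⟨a', b', c'⟩
  simp only [applyKrausMiddle, of_apply, Matrix.sum_apply]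
  refine Finset.sum_congr rfl fun i _ => ?_
  simp only [Matrix.mul_apply, Fintype.sum_prod_type, kroneckerMap_apply,
    conjTranspose_apply, one_apply, ite_mul, one_mul, zero_mul, Finset.sum_ite_irrel,
    Finset.sum_const_zero, Finset.sum_ite_eq, Finset.mem_univ, if_true, apply_ite star, star_zero,
    mul_ite, mul_zero, mul_one, Finset.sum_mul]
  exact Finset.sum_comm

theorem ptr2_applyKrausMiddle [Fintype B'] [DecidableEq B] {K : ι → Matrix B' B ℂ}
    (hK : ∑ i, (K i)ᴴ * K i = 1) (ρ : Matrix (A × B × C) (A × B × C) ℂ) :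
    ptr2 (applyKrausMiddle K ρ) = ptr2 ρ := by
  ext ⟨a, c⟩ ⟨a', c'⟩
  have h : ∀ b b', ∑ i, ∑ y, star (K i y b') * K i y b = if b' = b then 1 else 0 := by
    intro b b'
    have := congrFun (congrFun hK b') b
    simpa [Matrix.sum_apply, Matrix.mul_apply, one_apply] using this
  simp only [ptr2, applyKrausMiddle, of_apply]
  calc _ = ∑ b, ∑ b', (∑ i, ∑ y, star (K i y b') * K i y b) * ρ (a, b, c) (a', b', c') := by
        simp only [Finset.sum_mul]
        rw [Finset.sum_comm]
        conv_rhs =>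
          enter [2, b]
          rw [Finset.sum_comm]
        conv_rhs => rw [Finset.sum_comm]
        refine Finset.sum_congr rfl fun i _ => ?_
        rw [Finset.sum_comm]
        refine Finset.sum_congr rfl fun b _ => ?_
        rw [Finset.sum_comm]
        refine Finset.sum_congr rfl fun b' _ => Finset.sum_congr rfl fun y _ => ?_
        ring
    _ = _ := by simp only [h, ite_mul, one_mul, zero_mul, Finset.sum_ite_eq',
          Finset.mem_univ, if_true]

theorem ptr12_eq_traceLeft_ptr2 [Fintype A] (ρ : Matrix (A × B × C) (A × B × C) ℂ) :
    ptr12 ρ = traceLeft (ptr2 ρ) := rfl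

end

end Helpers

/-- Quantum conditional mutual information is monotone under a local
channel acting on system `B`: for any quantum channel `N` (given by Kraus operators `K`
with `∑ᵢ Kᵢᴴ Kᵢ = 1`) acting on `B`, `I(A:B|C)_ρ ≥ I(A:B'|C)_{N(ρ)}`. -/
theorem cmi_data_processing
    {A B C B' ι : Type*} [Fintype A] [Fintype B] [Fintype C] [Fintype B'] [Fintype ι]
    [DecidableEq A] [DecidableEq B] [DecidableEq C] [DecidableEq B']
    (K : ι → Matrix B' B ℂ) (hK : ∑ i, (K i)ᴴ * K i = 1)
    (ρ : Matrix (A × B × C) (A × B × C) ℂ) (hρ : ρ.PosSemidef) (htr : ρ.trace = 1) :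
    cmi (applyKrausMiddle K ρ) ≤ cmi ρ := by
  have key : vnEntropy (ptr1 (applyKrausMiddle K ρ)) - vnEntropy (applyKrausMiddle K ρ) ≤
      vnEntropy (ptr1 ρ) - vnEntropy ρ :=
    vnEntropy_traceLeft_sub_channel_le _ (sum_conjTranspose_kronecker_one hK) hρ
      (applyKrausMiddle_eq_sum K ρ)
  unfold cmi
  rw [ptr12_eq_traceLeft_ptr2, ptr12_eq_traceLeft_ptr2, ptr2_applyKrausMiddle hK]
  linarith

end QI
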